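/- Equivalence of the conditional convex order and the concordance order for bivariate stochastically increasing random vectors (Proposition). Let (Y,X) and (Y',X') be bivariate stochastically increasing (SI) random vectors with Y equal in distribution to Y' and X equal in distribution to X'. Then (Y,X) ⪯ccx (Y',X') if and only if (Y,X) ≤c (Y',X'). In particular, (Y,X) =ccx (Y',X') if and only if (Y,X) and (Y',X') have the same distribution. -/

import Mathlib

open MeasureTheory ProbabilityTheory Set Filter

noncomputable section

namespace CCXPaper

variable {Ω Ω' : Type*} [MeasurableSpace Ω] [MeasurableSpace Ω']

/-- A measure is non-atomic in the measure-theoretic sense: every set of positive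
measure contains a measurable subset of strictly smaller positive measure. -/
def Nonatomic (P : Measure Ω) : Prop :=
  ∀ s : Set Ω, MeasurableSet s → 0 < P s →
    ∃ t : Set Ω, MeasurableSet t ∧ t ⊆ s ∧ 0 < P t ∧ P t < P s

/-- Cumulative distribution function of the real random variable `Y` under `P`. -/
def cdfRV (P : Measure Ω) (Y : Ω → ℝ) (y : ℝ) : ℝ :=
  (P {ω | Y ω ≤ y}).toReal

/-- Quantile function `q_Y(v) = inf {y | F_Y(y) ≥ v}`. -/
def quantRV (P : Measure Ω) (Y : Ω → ℝ) (v : ℝ) : ℝ :=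
  sInf {y : ℝ | v ≤ cdfRV P Y y}

/-- Convex order between real random variables (on possibly different spaces):
`E[φ(S)] ≤ E[φ(T)]` for every convex `φ : ℝ → ℝ`. -/
def CxLE (P : Measure Ω) (S : Ω → ℝ) (P' : Measure Ω') (T : Ω' → ℝ) : Prop :=
  ∀ φ : ℝ → ℝ, ConvexOn ℝ Set.univ φ →
    ∫ ω, φ (S ω) ∂P ≤ ∫ ω, φ (T ω) ∂P'

/-- Conditional probability `P(s | X)` as a random variable (a version of the
conditional expectation of the indicator of `s` given `σ(X)`). -/
def condProb {β : Type*} [MeasurableSpace β] (P : Measure Ω) (X : Ω → β) (s : Set Ω) :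
    Ω → ℝ :=
  P[s.indicator (fun _ => (1 : ℝ)) | MeasurableSpace.comap X inferInstance]

/-- Conditional survival probability `P(Y ≥ y | X)`. -/
def condProbGE {β : Type*} [MeasurableSpace β] (P : Measure Ω) (Y : Ω → ℝ) (X : Ω → β)
    (y : ℝ) : Ω → ℝ :=
  condProb P X {ω | y ≤ Y ω}

/-- Conditional strict survival probability `P(Y > y | X)`. -/
def condProbGT {β : Type*} [MeasurableSpace β] (P : Measure Ω) (Y : Ω → ℝ) (X : Ω → β)
    (y : ℝ) : Ω → ℝ :=
  condProb P X {ω | y < Y ω}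

/-- Conditional cumulative probability `P(Y ≤ y | X)`. -/
def condProbLE {β : Type*} [MeasurableSpace β] (P : Measure Ω) (Y : Ω → ℝ) (X : Ω → β)
    (y : ℝ) : Ω → ℝ :=
  condProb P X {ω | Y ω ≤ y}

/-- Conditional strict cumulative probability `P(Y < y | X)`. -/
def condProbLT {β : Type*} [MeasurableSpace β] (P : Measure Ω) (Y : Ω → ℝ) (X : Ω → β)
    (y : ℝ) : Ω → ℝ :=
  condProb P X {ω | Y ω < y}

/-- The conditional convex order `(Y, X) ⪯ccx (Y', X')`:
`P(Y ≥ q_Y(v) | X) ≤cx P(Y' ≥ q_{Y'}(v) | X')` for all `v ∈ (0,1)`. -/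
def CCX {β γ : Type*} [MeasurableSpace β] [MeasurableSpace γ]
    (P : Measure Ω) (Y : Ω → ℝ) (X : Ω → β)
    (P' : Measure Ω') (Y' : Ω' → ℝ) (X' : Ω' → γ) : Prop :=
  ∀ v ∈ Set.Ioo (0 : ℝ) 1,
    CxLE P (condProbGE P Y X (quantRV P Y v)) P' (condProbGE P' Y' X' (quantRV P' Y' v))

/-- Equality in the conditional convex order: `(Y, X) =ccx (Y', X')`. -/
def CCXeq {β γ : Type*} [MeasurableSpace β] [MeasurableSpace γ]
    (P : Measure Ω) (Y : Ω → ℝ) (X : Ω → β)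
    (P' : Measure Ω') (Y' : Ω' → ℝ) (X' : Ω' → γ) : Prop :=
  CCX P Y X P' Y' X' ∧ CCX P' Y' X' P Y X

/-- `Y` and `Z` are conditionally independent given `X`: for every Borel `B ⊆ ℝ`,
`P(Y ∈ B | (X, Z)) = P(Y ∈ B | X)` almost surely. -/
def CondIndepGiven {β γ : Type*} [MeasurableSpace β] [MeasurableSpace γ]
    (P : Measure Ω) (Y : Ω → ℝ) (Z : Ω → γ) (X : Ω → β) : Prop :=
  ∀ B : Set ℝ, MeasurableSet B →
    condProb P (fun ω => (X ω, Z ω)) (Y ⁻¹' B) =ᵐ[P] condProb P X (Y ⁻¹' B)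

/-- `Y` is perfectly dependent on `X`: `Y = f(X)` a.s. for some measurable `f`. -/
def PerfectDep {β : Type*} [MeasurableSpace β] (P : Measure Ω) (Y : Ω → ℝ) (X : Ω → β) :
    Prop :=
  ∃ f : β → ℝ, Measurable f ∧ Y =ᵐ[P] fun ω => f (X ω)

/-- Concordance order for bivariate random vectors `(T, S) ≤c (T', S')`. -/
def ConcordLE (P : Measure Ω) (T S : Ω → ℝ) (P' : Measure Ω') (T' S' : Ω' → ℝ) : Prop :=
  ∀ t s : ℝ,
    P {ω | T ω ≤ t ∧ S ω ≤ s} ≤ P' {ω | T' ω ≤ t ∧ S' ω ≤ s} ∧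
    P {ω | t < T ω ∧ s < S ω} ≤ P' {ω | t < T' ω ∧ s < S' ω}

/-- The bivariate random vector `(W₁, W₂)` is stochastically increasing (SI):
for each bounded increasing `f`, a version of `E[f(W₁) | W₂]` is an increasing
function of `W₂`. -/
def SIvec (P : Measure Ω) (W₁ W₂ : Ω → ℝ) : Prop :=
  ∀ f : ℝ → ℝ, Monotone f → (∃ C : ℝ, ∀ x, |f x| ≤ C) →
    ∃ m : ℝ → ℝ, Monotone m ∧
      (fun ω => m (W₂ ω)) =ᵐ[P]
        P[(fun ω => f (W₁ ω)) | MeasurableSpace.comap W₂ inferInstance]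

/-- `G` is a cumulative distribution function on `ℝ`. -/
def IsCDF (G : ℝ → ℝ) : Prop :=
  Monotone G ∧ (∀ y : ℝ, ContinuousWithinAt G (Set.Ici y) y) ∧
    Tendsto G atBot (nhds 0) ∧ Tendsto G atTop (nhds 1)

/-- `(F u)_{u ∈ (0,1)}` is a rearranged conditional distribution family for `(Y, X)`:
each `F u` is a cdf, `u ↦ F u y` is decreasing, and for each `y` the function
`u ↦ F u y` on `(0,1)` is a rearrangement of (i.e. equidistributed with)
`P(Y ≤ y | X)`. -/
def IsRearrangedFamily {β : Type*} [MeasurableSpace β]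
    (P : Measure Ω) (Y : Ω → ℝ) (X : Ω → β) (F : ℝ → ℝ → ℝ) : Prop :=
  (∀ u ∈ Set.Ioo (0 : ℝ) 1, IsCDF (F u)) ∧
  (∀ y : ℝ, AntitoneOn (fun u => F u y) (Set.Ioo (0 : ℝ) 1)) ∧
  (∀ y w : ℝ,
    volume {u ∈ Set.Ioo (0 : ℝ) 1 | w ≤ F u y} = P {ω | w ≤ condProbLE P Y X y ω})

/-- Rearranged quantile transform `q^{↑u}_{Y|X}(t) = inf {y | F_u(y) ≥ t}`. -/
def qArr (F : ℝ → ℝ → ℝ) (u t : ℝ) : ℝ :=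
  sInf {y : ℝ | t ≤ F u y}

/-- The uniform distribution on `(0,1)`. -/
def unif01 : Measure ℝ := volume.restrict (Set.Ioo (0 : ℝ) 1)

/-- `hs` is a decreasing rearrangement of `h : (0,1)^k → ℝ`. -/
def IsDecRearrangement {k : ℕ} (h : (Fin k → ℝ) → ℝ) (hs : ℝ → ℝ) : Prop :=
  AntitoneOn hs (Set.Ioo (0 : ℝ) 1) ∧
  ∀ w : ℝ,
    volume {t ∈ Set.Ioo (0 : ℝ) 1 | w ≤ hs t} =
      volume {x ∈ Set.pi Set.univ (fun _ : Fin k => Set.Ioo (0 : ℝ) 1) | w ≤ h x}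

/-- Schur order `f ≺_S g` for functions on unit cubes, via decreasing rearrangements. -/
def SchurLE {d d' : ℕ} (f : (Fin d → ℝ) → ℝ) (g : (Fin d' → ℝ) → ℝ) : Prop :=
  ∃ fs gs : ℝ → ℝ, IsDecRearrangement f fs ∧ IsDecRearrangement g gs ∧
    (∀ x ∈ Set.Ioo (0 : ℝ) 1,
      (∫ t in Set.Ioo (0 : ℝ) x, fs t) ≤ ∫ t in Set.Ioo (0 : ℝ) x, gs t) ∧
    (∫ t in Set.Ioo (0 : ℝ) 1, fs t) = ∫ t in Set.Ioo (0 : ℝ) 1, gs t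

/-- `κ` is a Markov-kernel version of the conditional cdf of `Y` given `X`. -/
def IsCondCDFKernel {β : Type*} [MeasurableSpace β]
    (P : Measure Ω) (Y : Ω → ℝ) (X : Ω → β) (κ : β → ℝ → ℝ) : Prop :=
  (∀ y : ℝ, Measurable fun x => κ x y) ∧
  ∀ y : ℝ, (fun ω => κ (X ω) y) =ᵐ[P] condProbLE P Y X y

/-- The dependence measure `ξ_φ(Y, X)` (with conditional cdf kernel `κ`). -/
def xiPhi {β : Type*} [MeasurableSpace β] (P : Measure Ω) (Y : Ω → ℝ) (X : Ω → β)
    (κ : β → ℝ → ℝ) (φ : ℝ → ℝ) : ℝ :=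
  (∫ y1, ∫ y, φ ((if y1 ≤ y then (1 : ℝ) else 0) - cdfRV P Y y) ∂(P.map Y) ∂(P.map Y))⁻¹ *
    ∫ x, ∫ y, φ (κ x y - cdfRV P Y y) ∂(P.map Y) ∂(P.map X)

/-- The dependence measure `Λ_φ(Y, X)` (with conditional cdf kernel `κ`). -/
def LamPhi {β : Type*} [MeasurableSpace β] (P : Measure Ω) (Y : Ω → ℝ) (X : Ω → β)
    (κ : β → ℝ → ℝ) (φ : ℝ → ℝ) : ℝ :=
  (∫ y12 : ℝ × ℝ, ∫ y,
      φ ((if y12.1 ≤ y then (1 : ℝ) else 0) - if y12.2 ≤ y then (1 : ℝ) else 0)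
      ∂(P.map Y) ∂((P.map Y).prod (P.map Y)))⁻¹ *
    ∫ x12 : β × β, ∫ y, φ (κ x12.1 y - κ x12.2 y) ∂(P.map Y) ∂((P.map X).prod (P.map X))

/-- `φ` vanishes at `0` and is strictly convex at `0`. -/
def StrictlyConvexAtZero (φ : ℝ → ℝ) : Prop :=
  φ 0 = 0 ∧
    ∀ s t lam : ℝ, s < 0 → 0 < t → 0 < lam → lam < 1 → lam * s + (1 - lam) * t = 0 →
      0 < lam * φ s + (1 - lam) * φ t

/-- `μ` is the (possibly degenerate) Gaussian distribution `N(m, S)` on `ℝ^d`,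
characterized via its characteristic function. -/
def IsGaussianPi {d : ℕ} (μ : Measure (Fin d → ℝ)) (m : Fin d → ℝ)
    (S : Matrix (Fin d) (Fin d) ℝ) : Prop :=
  ∀ t : Fin d → ℝ,
    (∫ x, Complex.exp (Complex.I * ((∑ i, t i * x i : ℝ) : ℂ)) ∂μ) =
      Complex.exp (Complex.I * ((∑ i, t i * m i : ℝ) : ℂ) -
        ((∑ i, ∑ j, t i * S i j * t j : ℝ) : ℂ) / 2)

/-- `Y` and `X` are comonotone. -/
def Comonotone (P : Measure Ω) (Y X : Ω → ℝ) : Prop :=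
  ∃ U : Ω → ℝ, Measurable U ∧ P.map U = unif01 ∧
    P.map (fun ω => (Y ω, X ω)) =
      P.map (fun ω => (quantRV P Y (U ω), quantRV P X (U ω)))

/-- `Y` and `X` are countermonotone. -/
def Countermonotone (P : Measure Ω) (Y X : Ω → ℝ) : Prop :=
  ∃ U : Ω → ℝ, Measurable U ∧ P.map U = unif01 ∧
    P.map (fun ω => (Y ω, X ω)) =
      P.map (fun ω => (quantRV P Y (U ω), quantRV P X (1 - U ω)))

end CCXPaper

namespace CCXPaper

open scoped Topology

set_option linter.unusedSectionVars false

lemma upper_le (μ ν : Measure ℝ) [IsFiniteMeasure μ] [IsFiniteMeasure ν]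
    (h : ∀ s, μ (Ioi s) ≤ ν (Ioi s)) (U : Set ℝ) (hU : IsUpperSet U) : μ U ≤ ν U := by
  rcases U.eq_empty_or_nonempty with rfl | hne
  · simp
  by_cases hb : BddBelow U
  · by_cases ha : sInf U ∈ U
    · have hUe : U = Ici (sInf U) := by
        ext x
        exact ⟨fun hx => csInf_le hb hx, fun hx => hU hx ha⟩
      rw [hUe]
      set a := sInf U
      have key : ∀ ρ : Measure ℝ, IsFiniteMeasure ρ →
          Tendsto (fun n : ℕ => ρ (Ioi (a - 1 / ((n : ℝ) + 1)))) atTop (𝓝 (ρ (Ici a))) := by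
        intro ρ _
        have hI : Ici a = ⋂ n : ℕ, Ioi (a - 1 / ((n : ℝ) + 1)) := by
          ext x
          simp only [mem_Ici, mem_iInter, mem_Ioi]
          constructor
          · intro hx n
            have : (0 : ℝ) < 1 / ((n : ℝ) + 1) := by positivity
            linarith
          · intro hx
            by_contra hc
            push Not at hc
            obtain ⟨n, hn⟩ := exists_nat_one_div_lt (sub_pos.2 hc)
            have := hx n
            linarith
        rw [hI]
        refine tendsto_measure_iInter_atTop (fun i => measurableSet_Ioi.nullMeasurableSet) ?_
          ⟨0, measure_ne_top _ _⟩
        intro i j hij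
        apply Ioi_subset_Ioi
        have := Nat.one_div_le_one_div (α := ℝ) hij
        linarith
      exact le_of_tendsto_of_tendsto' (key μ inferInstance) (key ν inferInstance) (fun n => h _)
    · have hUe : U = Ioi (sInf U) := by
        ext x
        constructor
        · intro hx
          refine lt_of_le_of_ne (csInf_le hb hx) ?_
          rintro rfl
          exact ha hx
        · intro hx
          obtain ⟨z, hz, hzx⟩ := exists_lt_of_csInf_lt hne hx
          exact hU hzx.le hz
      rw [hUe]
      exact h _
  · have hUe : U = ⋃ n : ℕ, Ioi (-(n : ℝ)) := by
      ext x
      simp only [mem_iUnion, mem_Ioi]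
      constructor
      · intro _
        obtain ⟨n, hn⟩ := exists_nat_gt (-x)
        exact ⟨n, by linarith⟩
      · intro _
        by_contra hx
        apply hb
        refine ⟨x, fun z hz => ?_⟩
        by_contra hc
        exact hx (hU (not_le.1 hc).le hz)
    have hm : Monotone (fun n : ℕ => Ioi (-(n : ℝ))) := by
      intro i j hij
      apply Ioi_subset_Ioi
      have : (i : ℝ) ≤ j := by exact_mod_cast hij
      linarith
    rw [hUe]
    exact le_of_tendsto_of_tendsto' (tendsto_measure_iUnion_atTop hm)
      (tendsto_measure_iUnion_atTop hm) (fun n => h _)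

lemma integrable_bdd {Ω : Type*} [MeasurableSpace Ω] {μ : Measure Ω} [IsFiniteMeasure μ]
    {f : Ω → ℝ} (hf : Measurable f) {C : ℝ} (hC : ∀ x, |f x| ≤ C) : Integrable f μ :=
  Integrable.of_bound hf.aestronglyMeasurable C (Eventually.of_forall hC)

lemma integral_upper_le (μ ν : Measure ℝ) [IsFiniteMeasure μ] [IsFiniteMeasure ν]
    (huniv : μ univ = ν univ)
    (h : ∀ U, IsUpperSet U → μ U ≤ ν U) (g : ℝ → ℝ) (hg : Monotone g) (C : ℝ)
    (hC : ∀ x, |g x| ≤ C) : ∫ x, g x ∂μ ≤ ∫ x, g x ∂ν := by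
  have hnn : ∀ x, 0 ≤ g x + C := fun x => by have := abs_le.1 (hC x); linarith
  have hmeas : Measurable (fun x => g x + C) := hg.measurable.add_const C
  have hgi : ∀ ρ : Measure ℝ, IsFiniteMeasure ρ → Integrable g ρ :=
    fun ρ _ => integrable_bdd hg.measurable hC
  have h1 : ∫ x, (g x + C) ∂μ ≤ ∫ x, (g x + C) ∂ν := by
    rw [integral_eq_lintegral_of_nonneg_ae (Eventually.of_forall hnn) hmeas.aestronglyMeasurable,
      integral_eq_lintegral_of_nonneg_ae (Eventually.of_forall hnn) hmeas.aestronglyMeasurable]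
    apply ENNReal.toReal_mono
    · exact ((hgi ν inferInstance).add (integrable_const C)).lintegral_lt_top.ne
    · rw [lintegral_eq_lintegral_meas_lt μ (Eventually.of_forall hnn) hmeas.aemeasurable,
        lintegral_eq_lintegral_meas_lt ν (Eventually.of_forall hnn) hmeas.aemeasurable]
      refine lintegral_mono fun t => h _ ?_
      intro a b hab (ha : t < g a + C)
      have := hg hab
      show t < g b + C
      linarith
  rw [integral_add (hgi μ inferInstance) (integrable_const C),
    integral_add (hgi ν inferInstance) (integrable_const C)] at h1
  have h2 : μ.real univ = ν.real univ := by simp [Measure.real, huniv]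
  simp only [integral_const, h2] at h1
  linarith

/-- Subgradients. -/
lemma subgrad (φ : ℝ → ℝ) (hφ : ConvexOn ℝ univ φ) :
    ∃ c : ℝ → ℝ, Monotone c ∧ ∀ z w, φ z + c z * (w - z) ≤ φ w := by
  refine ⟨fun z => derivWithin φ (Ioi z) z, ?_, ?_⟩
  · have := hφ.monotoneOn_rightDeriv
    simpa [monotoneOn_univ] using this
  · intro z w
    have hz : z ∈ interior (univ : Set ℝ) := by simp
    rcases lt_trichotomy z w with h | rfl | h
    · have := hφ.rightDeriv_le_slope_of_mem_interior hz (mem_univ w) h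
      rw [slope_def_field, le_div_iff₀ (by linarith)] at this
      linarith
    · simp
    · have h1 := hφ.slope_le_leftDeriv_of_mem_interior (mem_univ w) hz h
      have h2 := hφ.leftDeriv_le_rightDeriv_of_mem_interior hz
      have h3 := h1.trans h2
      rw [slope_def_field, div_le_iff₀ (by linarith)] at h3
      linarith

variable {Ω : Type*} [MeasurableSpace Ω] {P : Measure Ω} [IsProbabilityMeasure P]

lemma exists_version {Y X : Ω → ℝ} (hY : Measurable Y)
    (hSI : SIvec P Y X) (y : ℝ) :
    ∃ m : ℝ → ℝ, Monotone m ∧ (∀ x, 0 ≤ m x ∧ m x ≤ 1) ∧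
      (fun ω => m (X ω)) =ᵐ[P] condProbGE P Y X y := by
  obtain ⟨m, hm, hme⟩ := hSI ((Ici y).indicator (fun _ => 1)) (by
    intro a b hab
    by_cases ha : y ≤ a
    · simp [indicator, ha, ha.trans hab]
    · simp only [indicator, mem_Ici, ha, if_false]
      split_ifs <;> norm_num) ⟨1, fun x => by
        simp only [indicator]
        split_ifs <;> norm_num⟩
  have he : (fun ω => (Ici y).indicator (fun _ => (1 : ℝ)) (Y ω)) =
      ({ω | y ≤ Y ω} : Set Ω).indicator (fun _ => (1 : ℝ)) := by
    ext ω; simp [indicator]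
  rw [he] at hme
  have hmeasS : MeasurableSet {ω | y ≤ Y ω} := measurableSet_le measurable_const hY
  have h0 : 0 ≤ᵐ[P] condProbGE P Y X y :=
    condExp_nonneg (Eventually.of_forall fun ω => indicator_nonneg (fun _ _ => zero_le_one) ω)
  have h1 : condProbGE P Y X y ≤ᵐ[P] fun _ => (1 : ℝ) := by
    by_cases hle : MeasurableSpace.comap X inferInstance ≤ (inferInstance : MeasurableSpace Ω)
    · have := condExp_mono (m := MeasurableSpace.comap X inferInstance) (μ := P)
        (f := ({ω | y ≤ Y ω} : Set Ω).indicator (fun _ => (1 : ℝ))) (g := fun _ => (1 : ℝ))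
        ((integrable_const 1).indicator hmeasS) (integrable_const 1)
        (Eventually.of_forall fun ω => indicator_le_self' (fun _ _ => zero_le_one) ω)
      rwa [condExp_const hle] at this
    · unfold condProbGE condProb
      rw [condExp_of_not_le hle]
      exact Eventually.of_forall fun _ => zero_le_one
  refine ⟨fun x => max 0 (min 1 (m x)), ?_, ?_, ?_⟩
  · intro a b hab
    exact max_le_max le_rfl (min_le_min le_rfl (hm hab))
  · intro x
    exact ⟨le_max_left _ _, max_le zero_le_one (min_le_left _ _)⟩
  · filter_upwards [hme, h0, h1] with ω h2 h3 h4
    have h2' : m (X ω) = condProbGE P Y X y ω := h2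
    have h3' : 0 ≤ condProbGE P Y X y ω := h3
    show max 0 (min 1 (m (X ω))) = _
    rw [h2', min_eq_right h4, max_eq_right h3']

lemma integral_mul_version {Y X : Ω → ℝ} (hY : Measurable Y) (hX : Measurable X) (y : ℝ)
    (m : ℝ → ℝ) (hme : (fun ω => m (X ω)) =ᵐ[P] condProbGE P Y X y)
    (g : ℝ → ℝ) (hg : Measurable g) (C : ℝ) (hC : ∀ x, |g x| ≤ C) :
    ∫ ω, g (X ω) * m (X ω) ∂P = ∫ ω in {ω | y ≤ Y ω}, g (X ω) ∂P := by
  have hmeasS : MeasurableSet {ω | y ≤ Y ω} := measurableSet_le measurable_const hY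
  have h1 := condExp_stronglyMeasurable_mul_of_bound (μ := P)
    (m := MeasurableSpace.comap X inferInstance) hX.comap_le
    (f := fun ω => g (X ω)) (g := ({ω | y ≤ Y ω} : Set Ω).indicator (fun _ => (1 : ℝ)))
    (hg.comp (comap_measurable X)).stronglyMeasurable
    ((integrable_const 1).indicator hmeasS) C (Eventually.of_forall fun ω => hC _)
  calc ∫ ω, g (X ω) * m (X ω) ∂P = ∫ ω, (P[(fun ω => g (X ω)) *
        ({ω | y ≤ Y ω} : Set Ω).indicator (fun _ => (1 : ℝ)) |
          MeasurableSpace.comap X inferInstance]) ω ∂P := by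
        refine integral_congr_ae ?_
        filter_upwards [h1, hme] with ω h2 h3
        rw [h2]
        simp only [Pi.mul_apply]
        rw [h3]
        rfl
    _ = ∫ ω, ((fun ω => g (X ω)) *
        ({ω | y ≤ Y ω} : Set Ω).indicator (fun _ => (1 : ℝ))) ω ∂P := integral_condExp hX.comap_le
    _ = _ := by
        rw [← integral_indicator hmeasS]
        congr 1
        ext ω
        simp [indicator]

lemma integral_same_law {X X' : Ω → ℝ} (hX : Measurable X) (hX' : Measurable X')
    (hXd : P.map X = P.map X') (f : ℝ → ℝ) (hf : Measurable f) :
    ∫ ω, f (X ω) ∂P = ∫ ω, f (X' ω) ∂P := by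
  rw [← integral_map hX.aemeasurable hf.aestronglyMeasurable, hXd,
    integral_map hX'.aemeasurable hf.aestronglyMeasurable]

lemma measure_same_law {X X' : Ω → ℝ} (hX : Measurable X) (hX' : Measurable X')
    (hXd : P.map X = P.map X') {A : Set ℝ} (hA : MeasurableSet A) :
    P (X ⁻¹' A) = P (X' ⁻¹' A) := by
  rw [← Measure.map_apply hX hA, hXd, Measure.map_apply hX' hA]


lemma integral_ind {Y X : Ω → ℝ} (hY : Measurable Y) (hX : Measurable X) (y s : ℝ) :
    ∫ ω in {ω | y ≤ Y ω}, (Ioi s).indicator (fun _ => (1 : ℝ)) (X ω) ∂P =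
      P.real {ω | y ≤ Y ω ∧ s < X ω} := by
  have h1 : (fun ω => (Ioi s).indicator (fun _ => (1 : ℝ)) (X ω)) =
      ({ω | s < X ω} : Set Ω).indicator 1 := by
    ext ω; simp [indicator]
  have hm : MeasurableSet {ω | s < X ω} := measurableSet_lt measurable_const hX
  rw [h1, integral_indicator_one hm, measureReal_restrict_apply hm]
  congr 1
  ext ω
  simp [and_comm]

lemma abs_ind_le (s x : ℝ) : |(Ioi s).indicator (fun _ => (1 : ℝ)) x| ≤ 1 := by
  simp only [indicator]
  split_ifs <;> norm_num

lemma ccx_step {Y X Y' X' : Ω → ℝ}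
    (hY : Measurable Y) (hX : Measurable X) (hY' : Measurable Y') (hX' : Measurable X')
    (hSI : SIvec P Y X) (hSI' : SIvec P Y' X') (hXd : P.map X = P.map X') (y s : ℝ)
    (h : CxLE P (condProbGE P Y X y) P (condProbGE P Y' X' y)) :
    P.real {ω | y ≤ Y ω ∧ s < X ω} ≤ P.real {ω | y ≤ Y' ω ∧ s < X' ω} := by
  obtain ⟨m, hm, hmb, hme⟩ := exists_version hY hSI y
  obtain ⟨m', hm', hmb', hme'⟩ := exists_version hY' hSI' y
  set g : ℝ → ℝ := (Ioi s).indicator (fun _ => (1 : ℝ)) with hg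
  have hgm : Measurable g := measurable_const.indicator measurableSet_Ioi
  have e1 := integral_mul_version hY hX y m hme g hgm 1 (abs_ind_le s)
  have e2 := integral_mul_version hY' hX' y m' hme' g hgm 1 (abs_ind_le s)
  rw [integral_ind hY hX] at e1
  rw [integral_ind hY' hX'] at e2
  rw [← e1, ← e2]
  set c := m' s with hc
  have hφ : ConvexOn ℝ univ (fun z : ℝ => max (z - c) 0) := by
    refine ConvexOn.sup ?_ (convexOn_const 0 convex_univ)
    exact (convexOn_id convex_univ).sub (concaveOn_const c convex_univ)
  have h1 := h _ hφ
  have h2 : ∫ ω, max (condProbGE P Y X y ω - c) 0 ∂P = ∫ ω, max (m (X ω) - c) 0 ∂P := by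
    refine integral_congr_ae ?_
    filter_upwards [hme] with ω hω
    simp only [← hω]
  have h3 : ∫ ω, max (condProbGE P Y' X' y ω - c) 0 ∂P = ∫ ω, max (m' (X' ω) - c) 0 ∂P := by
    refine integral_congr_ae ?_
    filter_upwards [hme'] with ω hω
    simp only [← hω]
  have h1' : ∫ ω, max (m (X ω) - c) 0 ∂P ≤ ∫ ω, max (m' (X' ω) - c) 0 ∂P := by
    rw [← h2, ← h3]; exact h1
  have hmm : Measurable (fun ω => m (X ω)) := hm.measurable.comp hX
  have hmm' : Measurable (fun ω => m' (X' ω)) := hm'.measurable.comp hX'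
  have hgX : Measurable (fun ω => g (X ω)) := hgm.comp hX
  have hgX' : Measurable (fun ω => g (X' ω)) := hgm.comp hX'
  have hg01 : ∀ x, 0 ≤ g x ∧ g x ≤ 1 := by
    intro x
    simp only [hg, indicator]
    split_ifs <;> norm_num
  have im : Integrable (fun ω => g (X ω) * m (X ω)) P := by
    refine integrable_bdd (hgX.mul hmm) (C := 1) fun ω => ?_
    rw [abs_of_nonneg (mul_nonneg (hg01 _).1 (hmb _).1)]
    exact mul_le_one₀ (hg01 _).2 (hmb _).1 (hmb _).2
  have im' : Integrable (fun ω => g (X' ω) * m' (X' ω)) P := by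
    refine integrable_bdd (hgX'.mul hmm') (C := 1) fun ω => ?_
    rw [abs_of_nonneg (mul_nonneg (hg01 _).1 (hmb' _).1)]
    exact mul_le_one₀ (hg01 _).2 (hmb' _).1 (hmb' _).2
  have ig : Integrable (fun ω => g (X ω) * c) P :=
    (integrable_bdd hgX (C := 1) fun ω => abs_ind_le s _).mul_const c
  have ig' : Integrable (fun ω => g (X' ω) * c) P :=
    (integrable_bdd hgX' (C := 1) fun ω => abs_ind_le s _).mul_const c
  have h4 : ∫ ω, (g (X ω) * m (X ω) - g (X ω) * c) ∂P ≤ ∫ ω, max (m (X ω) - c) 0 ∂P := by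
    refine integral_mono (im.sub ig) ?_ ?_
    · refine ((integrable_bdd hmm (C := 1) fun ω => ?_).sub (integrable_const c)).pos_part
      rw [abs_of_nonneg (hmb _).1]
      exact (hmb _).2
    · intro ω
      simp only [hg, indicator]
      split_ifs
      · simp
      · simp
  have h5 : ∫ ω, max (m' (X' ω) - c) 0 ∂P = ∫ ω, (g (X' ω) * m' (X' ω) - g (X' ω) * c) ∂P := by
    congr 1
    ext ω
    simp only [hg, indicator, mem_Ioi]
    split_ifs with hs
    · have := hm' hs.le
      rw [max_eq_left (by linarith)]
      ring
    · have := hm' (not_lt.1 hs)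
      rw [max_eq_right (by linarith)]
      ring
  have h6 : ∫ ω, g (X ω) * c ∂P = ∫ ω, g (X' ω) * c ∂P :=
    integral_same_law hX hX' hXd (fun x => g x * c) (hgm.mul_const c)
  rw [integral_sub im ig] at h4
  rw [integral_sub im' ig'] at h5
  linarith

lemma joint_upper {Y X Y' X' : Ω → ℝ}
    (hY : Measurable Y) (hX : Measurable X) (hY' : Measurable Y') (hX' : Measurable X')
    (h : ConcordLE P Y X P Y' X') (y : ℝ) (U : Set ℝ) (hU : IsUpperSet U) :
    ((P.restrict {ω | y ≤ Y ω}).map X) U ≤ ((P.restrict {ω | y ≤ Y' ω}).map X') U := by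
  refine upper_le _ _ (fun s => ?_) U hU
  rw [Measure.map_apply hX measurableSet_Ioi, Measure.map_apply hX' measurableSet_Ioi,
    Measure.restrict_apply (hX measurableSet_Ioi), Measure.restrict_apply (hX' measurableSet_Ioi)]
  have := upper_le ((P.restrict (X ⁻¹' Ioi s)).map Y) ((P.restrict (X' ⁻¹' Ioi s)).map Y')
    (fun t => by
      rw [Measure.map_apply hY measurableSet_Ioi, Measure.map_apply hY' measurableSet_Ioi,
        Measure.restrict_apply (hY measurableSet_Ioi),
        Measure.restrict_apply (hY' measurableSet_Ioi)]
      exact (h t s).2) (Ici y) (isUpperSet_Ici y)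
  rw [Measure.map_apply hY measurableSet_Ici, Measure.map_apply hY' measurableSet_Ici,
        Measure.restrict_apply (hY measurableSet_Ici),
        Measure.restrict_apply (hY' measurableSet_Ici), inter_comm, inter_comm (Y' ⁻¹' _)] at this
  exact this

lemma concord_step {Y X Y' X' : Ω → ℝ}
    (hY : Measurable Y) (hX : Measurable X) (hY' : Measurable Y') (hX' : Measurable X')
    (hSI : SIvec P Y X) (hSI' : SIvec P Y' X') (hYd : P.map Y = P.map Y')
    (hXd : P.map X = P.map X') (y : ℝ)
    (h : ConcordLE P Y X P Y' X') :
    CxLE P (condProbGE P Y X y) P (condProbGE P Y' X' y) := by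
  intro φ hφ
  obtain ⟨m, hm, hmb, hme⟩ := exists_version hY hSI y
  obtain ⟨m', hm', hmb', hme'⟩ := exists_version hY' hSI' y
  have h2 : ∫ ω, φ (condProbGE P Y X y ω) ∂P = ∫ ω, φ (m (X ω)) ∂P := by
    refine integral_congr_ae ?_
    filter_upwards [hme] with ω hω
    simp only [← hω]
  have h3 : ∫ ω, φ (condProbGE P Y' X' y ω) ∂P = ∫ ω, φ (m' (X' ω)) ∂P := by
    refine integral_congr_ae ?_
    filter_upwards [hme'] with ω hω
    simp only [← hω]
  rw [h2, h3]
  have hφc : Continuous φ := by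
    rw [← continuousOn_univ]
    exact hφ.continuousOn isOpen_univ
  obtain ⟨c, hcm, hc⟩ := subgrad φ hφ
  set g : ℝ → ℝ := fun x => c (m x) with hg
  have hgmono : Monotone g := hcm.comp hm
  have hgm : Measurable g := hgmono.measurable
  set C := max |c 0| |c 1|
  have hC : ∀ x, |g x| ≤ C := fun x =>
    abs_le_max_abs_abs (hcm (hmb x).1) (hcm (hmb x).2)
  have e1 := integral_mul_version hY hX y m hme g hgm C hC
  have e2 := integral_mul_version hY' hX' y m' hme' g hgm C hC
  have hle : ∫ ω in {ω | y ≤ Y ω}, g (X ω) ∂P ≤ ∫ ω in {ω | y ≤ Y' ω}, g (X' ω) ∂P := by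
    have := integral_upper_le ((P.restrict {ω | y ≤ Y ω}).map X)
      ((P.restrict {ω | y ≤ Y' ω}).map X') (by
        rw [Measure.map_apply hX .univ, Measure.map_apply hX' .univ]
        simp only [preimage_univ, Measure.restrict_apply_univ]
        exact measure_same_law hY hY' hYd (measurableSet_Ici (a := y)))
      (joint_upper hY hX hY' hX' h y) g hgmono C hC
    rwa [integral_map hX.aemeasurable hgm.aestronglyMeasurable,
      integral_map hX'.aemeasurable hgm.aestronglyMeasurable] at this
  rw [← e1, ← e2, ← integral_same_law hX hX' hXd (fun x => g x * m' x)
    (hgm.mul hm'.measurable)] at hle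
  rw [← integral_same_law hX hX' hXd (fun x => φ (m' x)) (hφc.measurable.comp hm'.measurable)]
  obtain ⟨D, hD⟩ := (isCompact_Icc (a := (0 : ℝ)) (b := 1)).exists_bound_of_continuousOn
    hφc.continuousOn
  have iφ : ∀ k : ℝ → ℝ, Monotone k → (∀ x, 0 ≤ k x ∧ k x ≤ 1) →
      Integrable (fun ω => φ (k (X ω))) P := fun k hk hkb =>
    integrable_bdd (hφc.measurable.comp (hk.measurable.comp hX)) (fun ω => hD _ (hkb _))
  have ig : ∀ k : ℝ → ℝ, Monotone k → (∀ x, 0 ≤ k x ∧ k x ≤ 1) →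
      Integrable (fun ω => g (X ω) * k (X ω)) P := fun k hk hkb => by
    refine integrable_bdd ((hgm.comp hX).mul (hk.measurable.comp hX)) (C := C * 1) (fun ω => ?_)
    rw [abs_mul]
    refine mul_le_mul (hC _) ?_ (abs_nonneg _) ((abs_nonneg _).trans (hC 0))
    rw [abs_of_nonneg (hkb _).1]
    exact (hkb _).2
  have h7 : ∫ ω, (φ (m (X ω)) + (g (X ω) * m' (X ω) - g (X ω) * m (X ω))) ∂P ≤
      ∫ ω, φ (m' (X ω)) ∂P := by
    refine integral_mono ((iφ m hm hmb).add ((ig m' hm' hmb').sub (ig m hm hmb)))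
      (iφ m' hm' hmb') fun ω => ?_
    have := hc (m (X ω)) (m' (X ω))
    simp only [hg]
    linarith
  have i8 : Integrable (fun ω => g (X ω) * m' (X ω) - g (X ω) * m (X ω)) P :=
    (ig m' hm' hmb').sub (ig m hm hmb)
  rw [integral_add (iφ m hm hmb) i8,
    integral_sub (ig m' hm' hmb') (ig m hm hmb)] at h7
  linarith

lemma cdfRV_eq (Y : Ω → ℝ) (hY : Measurable Y) (y : ℝ) :
    cdfRV P Y y = (P.map Y).real (Iic y) := by
  rw [map_measureReal_apply hY measurableSet_Iic]
  rfl

lemma quantRV_same {Y Y' : Ω → ℝ} (hY : Measurable Y) (hY' : Measurable Y')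
    (hYd : P.map Y = P.map Y') (v : ℝ) : quantRV P Y v = quantRV P Y' v := by
  unfold quantRV
  simp only [cdfRV_eq _ hY, cdfRV_eq _ hY', hYd]

/-- Quantile facts. -/
lemma quant_facts {Y : Ω → ℝ} (hY : Measurable Y) (t v : ℝ) (hv : v ∈ Ioo (0 : ℝ) 1)
    (htv : cdfRV P Y t < v) :
    t < quantRV P Y v ∧ P.real {ω | Y ω < quantRV P Y v} ≤ v := by
  have : IsProbabilityMeasure (P.map Y) := Measure.isProbabilityMeasure_map hY.aemeasurable
  have hF : ∀ y, cdfRV P Y y = cdf (P.map Y) y := fun y => by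
    rw [cdfRV_eq _ hY, cdf_eq_real]
  have hmono : Monotone (cdfRV P Y) := fun a b hab => by
    rw [hF, hF]; exact monotone_cdf _ hab
  set S := {y : ℝ | v ≤ cdfRV P Y y} with hS
  have hne : S.Nonempty := by
    have h1 := tendsto_cdf_atTop (P.map Y)
    obtain ⟨y, hy⟩ := (h1.eventually (eventually_gt_nhds hv.2)).exists
    exact ⟨y, by rw [hS, mem_ofPred_eq, hF]; exact hy.le⟩
  have hlb : ∀ y ∈ S, t < y := fun y hy => by
    by_contra hc
    have := hmono (not_lt.1 hc)
    have hy' : v ≤ cdfRV P Y y := hy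
    linarith
  have hbdd : BddBelow S := ⟨t, fun y hy => (hlb y hy).le⟩
  have hlow : ∀ y < quantRV P Y v, cdfRV P Y y < v := fun y hy => by
    by_contra hc
    exact absurd (csInf_le hbdd (show y ∈ S from not_lt.1 hc)) (not_le.2 hy)
  constructor
  · have hrc : ContinuousWithinAt (cdf (P.map Y)) (Ioi t) t :=
      ((cdf (P.map Y)).right_continuous t).mono Ioi_subset_Ici_self
    have h2 : ∀ᶠ y in 𝓝[>] t, cdf (P.map Y) y < v :=
      hrc.eventually (eventually_lt_nhds (by rw [← hF]; exact htv))
    obtain ⟨y, hy, hty⟩ := (h2.and self_mem_nhdsWithin).exists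
    refine lt_of_lt_of_le (show t < y from hty) (le_csInf hne fun z hz => ?_)
    by_contra hc
    have := hmono (not_le.1 hc).le
    have hz' : v ≤ cdfRV P Y z := hz
    rw [← hF] at hy
    linarith
  · set q := quantRV P Y v
    have hU : {ω | Y ω < q} = ⋃ n : ℕ, {ω | Y ω ≤ q - 1 / ((n : ℝ) + 1)} := by
      ext ω
      simp only [mem_ofPred_eq, mem_iUnion]
      constructor
      · intro h
        obtain ⟨n, hn⟩ := exists_nat_one_div_lt (sub_pos.2 h)
        exact ⟨n, by linarith⟩
      · rintro ⟨n, hn⟩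
        have : (0 : ℝ) < 1 / ((n : ℝ) + 1) := by positivity
        linarith
    have hm : Monotone (fun n : ℕ => {ω | Y ω ≤ q - 1 / ((n : ℝ) + 1)}) := by
      intro i j hij ω (hω : Y ω ≤ _)
      have := Nat.one_div_le_one_div (α := ℝ) hij
      show Y ω ≤ _
      linarith
    have h3 := (ENNReal.tendsto_toReal (measure_ne_top P _)).comp
      (tendsto_measure_iUnion_atTop (μ := P) hm)
    rw [← hU] at h3
    refine le_of_tendsto' h3 fun n => ?_
    refine (hlow (q - 1 / ((n : ℝ) + 1)) ?_).le
    have : (0 : ℝ) < 1 / ((n : ℝ) + 1) := by positivity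
    linarith

lemma ccx_to_concord {Y X Y' X' : Ω → ℝ}
    (hY : Measurable Y) (hX : Measurable X) (hY' : Measurable Y') (hX' : Measurable X')
    (hSI : SIvec P Y X) (hSI' : SIvec P Y' X') (hYd : P.map Y = P.map Y')
    (hXd : P.map X = P.map X') (h : CCX P Y X P Y' X') :
    ConcordLE P Y X P Y' X' := by
  have key : ∀ t s : ℝ, P.real {ω | t < Y ω ∧ s < X ω} ≤ P.real {ω | t < Y' ω ∧ s < X' ω} := by
    intro t s
    have hF0 : 0 ≤ cdfRV P Y t := ENNReal.toReal_nonneg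
    have hF1 : cdfRV P Y t ≤ 1 := measureReal_le_one
    have hcompl : P.real {ω | t < Y ω} = 1 - cdfRV P Y t := by
      have := probReal_compl_eq_one_sub (μ := P) (measurableSet_le hY (measurable_const (a := t)))
      have he : {ω | Y ω ≤ t}ᶜ = {ω | t < Y ω} := by ext; simp
      rw [he] at this
      exact this
    rcases hF1.lt_or_eq with hlt | heq
    · refine le_of_forall_pos_le_add fun ε hε => ?_
      set v := min (cdfRV P Y t + ε) ((cdfRV P Y t + 1) / 2) with hv
      have hv1 : cdfRV P Y t < v := lt_min (by linarith) (by linarith)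
      have hv2 : v ≤ cdfRV P Y t + ε := min_le_left _ _
      have hv3 : v < 1 := lt_of_le_of_lt (min_le_right _ _) (by linarith)
      have hv01 : v ∈ Ioo (0 : ℝ) 1 := ⟨by linarith, hv3⟩
      obtain ⟨hq1, hq2⟩ := quant_facts hY t v hv01 hv1
      have hst := h v hv01
      rw [← quantRV_same hY hY' hYd v] at hst
      have hst := ccx_step hY hX hY' hX' hSI hSI' hXd _ s hst
      set q := quantRV P Y v
      have a1 : P.real {ω | t < Y ω ∧ s < X ω} ≤
          P.real {ω | q ≤ Y ω ∧ s < X ω} + P.real {ω | t < Y ω ∧ Y ω < q} := by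
        refine (measureReal_mono ?_).trans (measureReal_union_le _ _)
        rintro ω ⟨h1, h2⟩
        rcases le_or_gt q (Y ω) with h3 | h3
        · exact Or.inl ⟨h3, h2⟩
        · exact Or.inr ⟨h1, h3⟩
      have a2 : P.real {ω | Y ω < q} = cdfRV P Y t + P.real {ω | t < Y ω ∧ Y ω < q} := by
        have he : {ω | Y ω < q} = {ω | Y ω ≤ t} ∪ {ω | t < Y ω ∧ Y ω < q} := by
          ext ω
          simp only [mem_ofPred_eq, mem_union]
          constructor
          · intro h1
            rcases le_or_gt (Y ω) t with h3 | h3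
            · exact Or.inl h3
            · exact Or.inr ⟨h3, h1⟩
          · rintro (h1 | h1)
            · linarith
            · exact h1.2
        rw [he, measureReal_union]
        · rfl
        · rw [Set.disjoint_left]
          intro ω h1 h2
          exact absurd h2.1 (not_lt.2 h1)
        · exact (measurableSet_lt measurable_const hY).inter (measurableSet_lt hY measurable_const)
      have a3 : P.real {ω | q ≤ Y' ω ∧ s < X' ω} ≤ P.real {ω | t < Y' ω ∧ s < X' ω} :=
        measureReal_mono fun ω hω => ⟨lt_of_lt_of_le hq1 hω.1, hω.2⟩
      linarith
    · have : P.real {ω | t < Y ω ∧ s < X ω} ≤ P.real {ω | t < Y ω} :=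
        measureReal_mono fun ω hω => hω.1
      have h0 : 0 ≤ P.real {ω | t < Y' ω ∧ s < X' ω} := measureReal_nonneg
      linarith
  intro t s
  have hk : P {ω | t < Y ω ∧ s < X ω} ≤ P {ω | t < Y' ω ∧ s < X' ω} :=
    (ENNReal.toReal_le_toReal (measure_ne_top _ _) (measure_ne_top _ _)).1 (key t s)
  refine ⟨?_, hk⟩
  -- inclusion-exclusion
  have ie : ∀ Z W : Ω → ℝ, Measurable Z → Measurable W →
      P.real {ω | Z ω ≤ t ∧ W ω ≤ s} =
        P.real (Z ⁻¹' Iic t) - P.real (W ⁻¹' Ioi s) + P.real {ω | t < Z ω ∧ s < W ω} := by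
    intro Z W hZ hW
    have h1 := measureReal_inter_add_sdiff (μ := P) (s := Z ⁻¹' Iic t)
      (hW (measurableSet_Iic (a := s)))
    have h2 := measureReal_inter_add_sdiff (μ := P) (s := W ⁻¹' Ioi s)
      (hZ (measurableSet_Iic (a := t)))
    have e1 : Z ⁻¹' Iic t \ W ⁻¹' Iic s = W ⁻¹' Ioi s ∩ Z ⁻¹' Iic t := by
      ext ω; simp [and_comm]
    have e2 : W ⁻¹' Ioi s \ Z ⁻¹' Iic t = {ω | t < Z ω ∧ s < W ω} := by
      ext ω; simp [and_comm]
    have e3 : Z ⁻¹' Iic t ∩ W ⁻¹' Iic s = {ω | Z ω ≤ t ∧ W ω ≤ s} := by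
      ext ω; simp
    rw [e1, e3] at h1
    rw [e2] at h2
    linarith
  refine (ENNReal.toReal_le_toReal (measure_ne_top _ _) (measure_ne_top _ _)).1 ?_
  have b1 := ie Y X hY hX
  have b2 := ie Y' X' hY' hX'
  have c1 : P.real (Y ⁻¹' Iic t) = P.real (Y' ⁻¹' Iic t) := by
    simp only [Measure.real, measure_same_law hY hY' hYd measurableSet_Iic]
  have c2 : P.real (X ⁻¹' Ioi s) = P.real (X' ⁻¹' Ioi s) := by
    simp only [Measure.real, measure_same_law hX hX' hXd measurableSet_Ioi]
  have := key t s
  change P.real _ ≤ P.real _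
  linarith

lemma ccx_iff {Y X Y' X' : Ω → ℝ}
    (hY : Measurable Y) (hX : Measurable X) (hY' : Measurable Y') (hX' : Measurable X')
    (hSI : SIvec P Y X) (hSI' : SIvec P Y' X') (hYd : P.map Y = P.map Y')
    (hXd : P.map X = P.map X') : CCX P Y X P Y' X' ↔ ConcordLE P Y X P Y' X' := by
  refine ⟨ccx_to_concord hY hX hY' hX' hSI hSI' hYd hXd, fun h v _ => ?_⟩
  rw [← quantRV_same hY hY' hYd v]
  exact concord_step hY hX hY' hX' hSI hSI' hYd hXd _ h

lemma law_eq_of_concord {Y X Y' X' : Ω → ℝ}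
    (hY : Measurable Y) (hX : Measurable X) (hY' : Measurable Y') (hX' : Measurable X')
    (h : ConcordLE P Y X P Y' X') (h' : ConcordLE P Y' X' P Y X) :
    P.map (fun ω => (Y ω, X ω)) = P.map (fun ω => (Y' ω, X' ω)) := by
  have h1 : ∀ t : ℝ, (P.restrict (Y ⁻¹' Iic t)).map X = (P.restrict (Y' ⁻¹' Iic t)).map X' := by
    intro t
    refine Measure.ext_of_Iic _ _ fun s => ?_
    rw [Measure.map_apply hX measurableSet_Iic, Measure.map_apply hX' measurableSet_Iic,
      Measure.restrict_apply (hX measurableSet_Iic),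
      Measure.restrict_apply (hX' measurableSet_Iic), inter_comm, inter_comm (X' ⁻¹' _)]
    exact le_antisymm (h t s).1 (h' t s).1
  have h2 : ∀ A : Set ℝ, MeasurableSet A →
      (P.restrict (X ⁻¹' A)).map Y = (P.restrict (X' ⁻¹' A)).map Y' := by
    intro A hA
    refine Measure.ext_of_Iic _ _ fun t => ?_
    rw [Measure.map_apply hY measurableSet_Iic, Measure.map_apply hY' measurableSet_Iic,
      Measure.restrict_apply (hY measurableSet_Iic),
      Measure.restrict_apply (hY' measurableSet_Iic), inter_comm, inter_comm (Y' ⁻¹' _)]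
    have := congrArg (fun ρ : Measure ℝ => ρ A) (h1 t)
    simp only [Measure.map_apply hX hA, Measure.map_apply hX' hA,
      Measure.restrict_apply (hX hA), Measure.restrict_apply (hX' hA)] at this
    exact this
  have : IsFiniteMeasure (P.map (fun ω => (Y ω, X ω))) := inferInstance
  refine Measure.ext_prod fun {B A} hB hA => ?_
  rw [Measure.map_apply (hY.prodMk hX) (hB.prod hA),
    Measure.map_apply (hY'.prodMk hX') (hB.prod hA)]
  have := congrArg (fun ρ : Measure ℝ => ρ B) (h2 A hA)
  simp only [Measure.map_apply hY hB, Measure.map_apply hY' hB,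
      Measure.restrict_apply (hY hB), Measure.restrict_apply (hY' hB)] at this
  exact this

lemma concord_of_law_eq {Y X Y' X' : Ω → ℝ}
    (hY : Measurable Y) (hX : Measurable X) (hY' : Measurable Y') (hX' : Measurable X')
    (h : P.map (fun ω => (Y ω, X ω)) = P.map (fun ω => (Y' ω, X' ω))) :
    ConcordLE P Y X P Y' X' := by
  have key : ∀ B A : Set ℝ, MeasurableSet B → MeasurableSet A →
      P (Y ⁻¹' B ∩ X ⁻¹' A) = P (Y' ⁻¹' B ∩ X' ⁻¹' A) := by
    intro B A hB hA
    have := congrArg (fun ρ : Measure (ℝ × ℝ) => ρ (B ×ˢ A)) h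
    simp only [Measure.map_apply (hY.prodMk hX) (hB.prod hA),
      Measure.map_apply (hY'.prodMk hX') (hB.prod hA)] at this
    exact this
  intro t s
  exact ⟨(key (Iic t) (Iic s) measurableSet_Iic measurableSet_Iic).le,
    (key (Ioi t) (Ioi s) measurableSet_Ioi measurableSet_Ioi).le⟩

end CCXPaper

open CCXPaper in
/-- For bivariate stochastically increasing random vectors `(Y, X)` and
`(Y', X')` with `Y ~ Y'` and `X ~ X'`: `(Y, X) ⪯ccx (Y', X')` iff
`(Y, X) ≤c (Y', X')`; in particular `(Y, X) =ccx (Y', X')` iff the joint laws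
coincide. -/
theorem ccx_iff_concordance_for_SI
    {Ω : Type*} [MeasurableSpace Ω] (P : Measure Ω) [IsProbabilityMeasure P]
    (hPna : Nonatomic P)
    (Y X Y' X' : Ω → ℝ)
    (hY : Measurable Y) (hX : Measurable X) (hY' : Measurable Y') (hX' : Measurable X')
    (hSI : SIvec P Y X) (hSI' : SIvec P Y' X')
    (hYd : P.map Y = P.map Y') (hXd : P.map X = P.map X') :
    (CCX P Y X P Y' X' ↔ ConcordLE P Y X P Y' X') ∧
    (CCXeq P Y X P Y' X' ↔
      P.map (fun ω => (Y ω, X ω)) = P.map (fun ω => (Y' ω, X' ω))) := by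
  refine ⟨ccx_iff hY hX hY' hX' hSI hSI' hYd hXd, ?_⟩
  unfold CCXeq
  rw [ccx_iff hY hX hY' hX' hSI hSI' hYd hXd,
    ccx_iff hY' hX' hY hX hSI' hSI hYd.symm hXd.symm]
  exact ⟨fun h => law_eq_of_concord hY hX hY' hX' h.1 h.2, fun h =>
    ⟨concord_of_law_eq hY hX hY' hX' h, concord_of_law_eq hY' hX' hY hX h.symm⟩⟩
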